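/- arXiv:2307.01769 — 3 statements merged into one kernel-verified Lean document; each statement's English description precedes it below -/
import Mathlib

section
/- Let a : ℝ → ℝ be differentiable, b : ℝ → ℝ, let f : ℝ → ℝ be twice differentiable with f(s) ≠ 0 for all s, and let h : ℝ → ℝ be differentiable. Then the two equations f' + 3h = a and h' - f + 2h²/f = b hold on ℝ if and only if h = (a - f')/3 on ℝ and f satisfies the second-order ODE f f'' - (2/3)(f')² + (4/3)a f' + 3f² + (3b - a')f = (2/3)a² on ℝ. -/
open Real

/-- Elimination of `h` from the system (2.26)-(2.27): the system is equivalent to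
`h = (a - f')/3` together with the second-order ODE for `f`. -/
theorem stmt_3 (a b f h : ℝ → ℝ)
    (ha : Differentiable ℝ a)
    (hfd : Differentiable ℝ f) (hfd' : Differentiable ℝ (deriv f))
    (hf0 : ∀ s, f s ≠ 0)
    (hhd : Differentiable ℝ h) :
    ((∀ s : ℝ, deriv f s + 3 * h s = a s) ∧
     (∀ s : ℝ, deriv h s - f s + 2 * (h s) ^ 2 / f s = b s)) ↔
    ((∀ s : ℝ, h s = (a s - deriv f s) / 3) ∧
     (∀ s : ℝ, f s * deriv (deriv f) s - (2 / 3) * (deriv f s) ^ 2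
        + (4 / 3) * a s * deriv f s + 3 * (f s) ^ 2
        + (3 * b s - deriv a s) * f s = (2 / 3) * (a s) ^ 2)) := by
  have first_iff : (∀ s : ℝ, deriv f s + 3 * h s = a s) ↔
      ∀ s : ℝ, h s = (a s - deriv f s) / 3 := by
    refine forall_congr' fun s => ⟨fun H => ?_, fun H => ?_⟩ <;> linarith
  rw [first_iff]
  refine and_congr_right fun hh => forall_congr' fun s => ?_
  have hderiv : deriv h s = (deriv a s - deriv (deriv f) s) / 3 := by
    rw [funext hh]
    exact (((ha s).hasDerivAt.sub (hfd' s).hasDerivAt).div_const 3).deriv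
  have hfs := hf0 s
  rw [hderiv, hh s]
  constructor
  · intro H
    field_simp at H
    linarith
  · intro H
    field_simp
    linarith
end

section
/- Let a₁, ..., a₆ be real numbers, N ≥ 1, and b₀, b₁, ..., b_N real numbers, with the convention b_m = 0 for m < 0 or m > N. Define f(φ) = Σ_{n=0}^{N} bₙ cos(nφ). Set A₀ = Σ_{n=1}^{N} ((1/2)a₃ - (5/6)n²)bₙ² + a₃b₀² - (1/2)a₁b₁ - a₂b₂ + (1/2)a₆b₂ + (1/2)a₅b₁ + a₄b₀ - (3/16)(a₁² + a₂²); for l ≥ 1, A_l = Σ_{k=1}^{N} ((1/2)a₃ - ((1/3)l + (5/6)k)k) b_{k+l} bₖ + Σ_{k=l+1}^{N+l} ((1/2)a₃ - ((5/6)k - (1/3)l)k) b_{k-l} bₖ - b₀ l² b_l + a₄ b_l + (1/2)a₅ b_{l-1} + (1/2)a₆ b_{l-2} + (1/2)a₅ b_{l+1} + (1/2)a₆ b_{l+2} + 2a₃ b₀ b_l + (1/2)a₁(l-1) b_{l-1} + (1/2)a₂(l-2) b_{l-2} - (1/2)a₁(l+1) b_{l+1} - (1/2)a₂(l+2) b_{l+2};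 B_l = Σ_{k=1}^{l-1} ((1/2)a₃ + ((1/3)l - (5/6)k)k) bₖ b_{l-k} for l ≥ 2 and B₁ = 0; C₁ = -(3/8)a₁a₂ + (1/2)a₅b₀ + (1/2)a₆b₁ - (1/2)a₂b₁, C₂ = (1/2)a₆b₀ + (3/16)a₁², C₃ = (3/8)a₁a₂, C₄ = (3/16)a₂², and C_l = 0 for l ≥ 5. Then for all φ ∈ ℝ: f(φ)f''(φ) - (2/3)f'(φ)² + (a₁ sin φ + a₂ sin 2φ)f'(φ) + a₃ f(φ)² + (a₄ + a₅ cos φ + a₆ cos 2φ)f(φ) - (3/8)(a₁ sin φ + a₂ sin 2φ)² = A₀ + Σ_{l=1}^{2N+4} (A_l + B_l + C_l) cos(lφ). -/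
open Real Finset

theorem sum_range_succ_eq_add_sum_Icc (g : ℕ → ℝ) (N : ℕ) :
    ∑ n ∈ range (N + 1), g n = g 0 + ∑ n ∈ Icc 1 N, g n := by
  induction N with
  | zero => simp
  | succ N ih => rw [sum_range_succ, ih, sum_Icc_succ_top (by omega), add_assoc]

theorem sum_Icc_shift_sub {G : ℤ → ℝ} {N M j : ℕ} (hG : ∀ m : ℤ, m < 0 ∨ (N : ℤ) < m → G m = 0)
    (hj : 1 ≤ j) (hM : N + j ≤ M) :
    ∑ l ∈ Icc 1 M, G ((l : ℤ) - j) = ∑ n ∈ range (N + 1), G n := by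
  symm
  refine sum_of_injOn (fun n => n + j) (fun x _ y _ h => by simpa using h) ?_ ?_ ?_
  · intro n hn
    simp only [coe_range, Set.mem_Iio, coe_Icc, Set.mem_Icc] at *
    omega
  · intro l hl hl'
    refine hG _ ?_
    by_contra h
    refine hl' ⟨l - j, ?_, ?_⟩
    · simp only [coe_range, Set.mem_Iio]
      omega
    · dsimp only
      omega
  · intro n _
    simp

theorem sum_Icc_shift_add {G : ℤ → ℝ} {N M : ℕ} (j : ℕ)
    (hG : ∀ m : ℤ, m < 0 ∨ (N : ℤ) < m → G m = 0) (hM : N ≤ M) :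
    ∑ l ∈ Icc 1 M, G ((l : ℤ) + j) =
      ∑ n ∈ range (N + 1), G n - ∑ n ∈ range (j + 1), G n := by
  have h₁ : ∑ n ∈ range (N + 1), G n = ∑ n ∈ range (j + 1 + M), G n := by
    refine sum_subset (range_subset_range.2 (by omega)) fun n _ hn => hG _ ?_
    simp only [mem_range] at hn
    omega
  have h₂ : ∑ l ∈ Icc 1 M, G ((l : ℤ) + j) = ∑ n ∈ range M, G ((j + 1 + n : ℕ) : ℤ) := by
    have h := sum_range_succ_eq_add_sum_Icc (fun l => G ((l : ℤ) + j)) M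
    rw [sum_range_succ'] at h
    have h' : ∑ n ∈ range M, G (((n + 1 : ℕ) : ℤ) + j) =
        ∑ n ∈ range M, G ((j + 1 + n : ℕ) : ℤ) :=
      sum_congr rfl fun n _ => by congr 1; push_cast; ring
    linarith
  rw [h₁, h₂, sum_range_add, add_sub_cancel_left]

theorem sum_Icc_antidiagonal {F : ℕ → ℕ → ℝ} {N M : ℕ} (hF : ∀ n k, N < n ∨ N < k → F n k = 0)
    (hM : 2 * N ≤ M) :
    ∑ l ∈ Icc 1 M, ∑ k ∈ Icc 1 (l - 1), F (l - k) k = ∑ n ∈ Icc 1 N, ∑ k ∈ Icc 1 N, F n k := by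
  rw [← sum_product', sum_sigma']
  symm
  refine sum_of_injOn (fun p => ⟨p.1 + p.2, p.2⟩) ?_ ?_ ?_ ?_
  · rintro ⟨a, b⟩ _ ⟨c, d⟩ _ h
    simp only [Sigma.mk.injEq, heq_eq_eq] at h
    simp only [Prod.mk.injEq]
    omega
  · rintro ⟨n, k⟩ h
    simp only [mem_coe, mem_product, mem_sigma, mem_Icc] at *
    omega
  · rintro ⟨l, k⟩ h h'
    simp only [mem_sigma, mem_Icc] at h
    refine hF (l - k) k ?_
    by_contra hc
    refine h' ⟨(l - k, k), ?_, ?_⟩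
    · simp only [mem_coe, mem_product, mem_Icc]
      omega
    · dsimp only
      rw [show l - k + k = l by omega]
  · rintro ⟨n, k⟩ _
    simp

theorem sum_Icc_lower {F : ℕ → ℕ → ℝ} {N M : ℕ} (hF : ∀ n k, N < n ∨ N < k → F n k = 0)
    (hM : N ≤ M) :
    ∑ l ∈ Icc 1 M, ∑ k ∈ Icc 1 N, F (k + l) k =
      ∑ p ∈ Icc 1 N ×ˢ Icc 1 N with p.2 < p.1, F p.1 p.2 := by
  rw [← sum_product']
  symm
  refine sum_of_injOn (fun p => (p.1 - p.2, p.2)) ?_ ?_ ?_ ?_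
  · rintro ⟨a, b⟩ h₁ ⟨c, d⟩ h₂ h
    simp only [mem_coe, mem_filter, mem_product, mem_Icc, Prod.mk.injEq] at *
    omega
  · rintro ⟨n, k⟩ h
    simp only [mem_coe, mem_filter, mem_product, mem_Icc] at *
    omega
  · rintro ⟨l, k⟩ h h'
    simp only [mem_product, mem_Icc] at h
    refine hF (k + l) k ?_
    by_contra hc
    refine h' ⟨(k + l, k), ?_, ?_⟩
    · simp only [mem_coe, mem_filter, mem_product, mem_Icc]
      omega
    · simp
  · rintro ⟨n, k⟩ h
    simp only [mem_filter, mem_product, mem_Icc] at h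
    simp only
    congr 1
    omega

theorem sum_Icc_upper {F : ℕ → ℕ → ℝ} {N M : ℕ} (hF : ∀ n k, N < n ∨ N < k → F n k = 0)
    (hM : N ≤ M) :
    ∑ l ∈ Icc 1 M, ∑ k ∈ Icc (l + 1) (N + l), F (k - l) k =
      ∑ p ∈ Icc 1 N ×ˢ Icc 1 N with p.1 < p.2, F p.1 p.2 := by
  rw [sum_sigma']
  symm
  refine sum_of_injOn (fun p => ⟨p.2 - p.1, p.2⟩) ?_ ?_ ?_ ?_
  · rintro ⟨a, b⟩ h₁ ⟨c, d⟩ h₂ h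
    simp only [Sigma.mk.injEq, heq_eq_eq] at h
    simp only [mem_coe, mem_filter, mem_product, mem_Icc, Prod.mk.injEq] at *
    omega
  · rintro ⟨n, k⟩ h
    simp only [mem_coe, mem_filter, mem_product, mem_sigma, mem_Icc] at *
    omega
  · rintro ⟨l, k⟩ h h'
    simp only [mem_sigma, mem_Icc] at h
    refine hF (k - l) k ?_
    by_contra hc
    refine h' ⟨(k - l, k), ?_, ?_⟩
    · simp only [mem_coe, mem_filter, mem_product, mem_Icc]
      omega
    · dsimp only
      rw [show k - (k - l) = l by omega]
  · rintro ⟨n, k⟩ h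
    simp only [mem_filter, mem_product, mem_Icc] at h
    simp only
    congr 1
    omega

theorem sum_Icc_trichotomy (F : ℕ → ℕ → ℝ) (N : ℕ) :
    ∑ n ∈ Icc 1 N, ∑ k ∈ Icc 1 N, F n k = ∑ n ∈ Icc 1 N, F n n +
      ∑ p ∈ Icc 1 N ×ˢ Icc 1 N with p.2 < p.1, F p.1 p.2 +
      ∑ p ∈ Icc 1 N ×ˢ Icc 1 N with p.1 < p.2, F p.1 p.2 := by
  have hdiag : ∑ n ∈ Icc 1 N, F n n =
      ∑ n ∈ Icc 1 N, ∑ k ∈ Icc 1 N, if n = k then F n k else 0 :=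
    sum_congr rfl fun n hn => by rw [sum_ite_eq, if_pos hn]
  rw [hdiag, sum_filter, sum_filter, ← sum_product', ← sum_product', ← sum_add_distrib,
    ← sum_add_distrib]
  refine sum_congr rfl fun p _ => ?_
  rcases lt_trichotomy p.1 p.2 with h | h | h
  · simp [h, h.ne, h.not_gt]
  · simp [h]
  · simp [h, h.ne', h.not_gt]

theorem deriv_cos_sum (c : ℕ → ℝ) (s : Finset ℕ) :
    deriv (fun φ : ℝ => ∑ n ∈ s, c n * cos (n * φ)) =
      fun φ => ∑ n ∈ s, -(n * c n) * sin (n * φ) := by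
  funext φ
  refine (HasDerivAt.fun_sum fun n _ => ?_).deriv
  have h := ((hasDerivAt_id φ).const_mul (n : ℝ)).cos.const_mul (c n)
  simp only [id, mul_one] at h
  exact h.congr_deriv (by ring)

theorem deriv_sin_sum (c : ℕ → ℝ) (s : Finset ℕ) :
    deriv (fun φ : ℝ => ∑ n ∈ s, c n * sin (n * φ)) =
      fun φ => ∑ n ∈ s, n * c n * cos (n * φ) := by
  funext φ
  refine (HasDerivAt.fun_sum fun n _ => ?_).deriv
  have h := ((hasDerivAt_id φ).const_mul (n : ℝ)).sin.const_mul (c n)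
  simp only [id, mul_one] at h
  exact h.congr_deriv (by ring)

/-- The part of the expansion that is quadratic in the coefficients. -/
theorem quadratic_cos_expansion (α : ℝ) {N M : ℕ} {b : ℤ → ℝ}
    (hb : ∀ m : ℤ, m < 0 ∨ (N : ℤ) < m → b m = 0) (hM : 2 * N ≤ M) (φ : ℝ) :
    (∑ n ∈ range (N + 1), b n * cos (n * φ)) *
          (∑ n ∈ range (N + 1), n * -(n * b n) * cos (n * φ))
        - (2 / 3) * (∑ n ∈ range (N + 1), -(n * b n) * sin (n * φ)) ^ 2
        + α * (∑ n ∈ range (N + 1), b n * cos (n * φ)) ^ 2 =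
      ∑ n ∈ Icc 1 N, ((1 / 2 : ℝ) * α - (5 / 6) * (n : ℝ) ^ 2) * b n ^ 2 + α * b 0 ^ 2 +
      ∑ l ∈ Icc 1 M,
        ((∑ k ∈ Icc 1 N,
            ((1 / 2 : ℝ) * α - ((1 / 3 : ℝ) * l + (5 / 6) * k) * k) * b (k + l) * b k)
          + (∑ k ∈ Icc (l + 1) (N + l),
            ((1 / 2 : ℝ) * α - ((5 / 6 : ℝ) * k - (1 / 3) * l) * k) * b ((k : ℤ) - l) * b k)
          - b 0 * (l : ℝ) ^ 2 * b l + 2 * α * b 0 * b l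
          + ∑ k ∈ Icc 1 (l - 1),
            ((1 / 2 : ℝ) * α + ((1 / 3 : ℝ) * l - (5 / 6) * k) * k) * b k * b ((l : ℤ) - k)) *
        cos (l * φ) := by
  let U : ℕ → ℕ → ℝ := fun n k =>
    (1 / 2) * (α - k ^ 2 - 2 / 3 * n * k) * b n * b k * cos ((n - k) * φ)
  let V : ℕ → ℕ → ℝ := fun n k =>
    (1 / 2) * (α - k ^ 2 + 2 / 3 * n * k) * b n * b k * cos ((n + k) * φ)
  have hb' : ∀ n : ℕ, N < n → b n = 0 := fun n hn => hb n (Or.inr (by exact_mod_cast hn))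
  have hU : ∀ n k, N < n ∨ N < k → U n k = 0 := by
    rintro n k (h | h) <;> simp [U, hb' _ h]
  have hV : ∀ n k, N < n ∨ N < k → V n k = 0 := by
    rintro n k (h | h) <;> simp [V, hb' _ h]
  have hprod : (∑ n ∈ range (N + 1), b n * cos (n * φ)) *
          (∑ n ∈ range (N + 1), n * -(n * b n) * cos (n * φ))
        - (2 / 3) * (∑ n ∈ range (N + 1), -(n * b n) * sin (n * φ)) ^ 2
        + α * (∑ n ∈ range (N + 1), b n * cos (n * φ)) ^ 2 =
      ∑ n ∈ range (N + 1), ∑ k ∈ range (N + 1), (U n k + V n k) := by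
    rw [sq, sq, sum_mul_sum, sum_mul_sum, sum_mul_sum]
    simp only [mul_sum, ← sum_sub_distrib, ← sum_add_distrib]
    refine sum_congr rfl fun n _ => sum_congr rfl fun k _ => ?_
    simp only [U, V, sub_mul, add_mul, cos_sub, cos_add]
    ring
  have hzero : ∑ n ∈ range (N + 1), ∑ k ∈ range (N + 1), (U n k + V n k) =
      α * b 0 ^ 2 + ∑ l ∈ Icc 1 N, (2 * α - l ^ 2) * b 0 * b l * cos (l * φ) +
      ∑ n ∈ Icc 1 N, ∑ k ∈ Icc 1 N, U n k + ∑ n ∈ Icc 1 N, ∑ k ∈ Icc 1 N, V n k := by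
    simp only [sum_range_succ_eq_add_sum_Icc, sum_add_distrib]
    have h : ∑ l ∈ Icc 1 N, (2 * α - l ^ 2) * b 0 * b l * cos (l * φ) =
        ∑ k ∈ Icc 1 N, U 0 k + ∑ k ∈ Icc 1 N, V 0 k +
        (∑ n ∈ Icc 1 N, U n 0 + ∑ n ∈ Icc 1 N, V n 0) := by
      simp only [← sum_add_distrib]
      refine sum_congr rfl fun l _ => ?_
      simp [U, V]
      ring
    have h₀ : U 0 0 + V 0 0 = α * b 0 ^ 2 := by
      simp [U, V]
      ring
    linarith
  have hext : ∑ l ∈ Icc 1 N, (2 * α - l ^ 2) * b 0 * b l * cos (l * φ) =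
      ∑ l ∈ Icc 1 M, (2 * α - (l : ℝ) ^ 2) * b 0 * b l * cos (l * φ) := by
    refine sum_subset (Icc_subset_Icc_right (by omega)) fun l hl hl' => ?_
    rw [hb' l (by simp only [mem_Icc] at hl hl'; omega)]
    ring
  have hdiag : ∑ n ∈ Icc 1 N, U n n =
      ∑ n ∈ Icc 1 N, ((1 / 2 : ℝ) * α - (5 / 6) * (n : ℝ) ^ 2) * b n ^ 2 := by
    refine sum_congr rfl fun n _ => ?_
    simp [U]
    ring
  rw [hprod, hzero, hext, sum_Icc_trichotomy, hdiag, ← sum_Icc_lower hU (M := M) (by omega),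
    ← sum_Icc_upper hU (M := M) (by omega), ← sum_Icc_antidiagonal hV hM]
  have hterm : ∀ l ∈ Icc 1 M,
      ((∑ k ∈ Icc 1 N,
            ((1 / 2 : ℝ) * α - ((1 / 3 : ℝ) * l + (5 / 6) * k) * k) * b (k + l) * b k)
          + (∑ k ∈ Icc (l + 1) (N + l),
            ((1 / 2 : ℝ) * α - ((5 / 6 : ℝ) * k - (1 / 3) * l) * k) * b ((k : ℤ) - l) * b k)
          - b 0 * (l : ℝ) ^ 2 * b l + 2 * α * b 0 * b l
          + ∑ k ∈ Icc 1 (l - 1),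
            ((1 / 2 : ℝ) * α + ((1 / 3 : ℝ) * l - (5 / 6) * k) * k) * b k * b ((l : ℤ) - k)) *
        cos (l * φ) =
      (2 * α - (l : ℝ) ^ 2) * b 0 * b l * cos (l * φ) + ∑ k ∈ Icc 1 N, U (k + l) k +
        ∑ k ∈ Icc (l + 1) (N + l), U (k - l) k + ∑ k ∈ Icc 1 (l - 1), V (l - k) k := by
    intro l _
    have h₁ : ∑ k ∈ Icc 1 N, U (k + l) k = (∑ k ∈ Icc 1 N,
        ((1 / 2 : ℝ) * α - ((1 / 3 : ℝ) * l + (5 / 6) * k) * k) * b (k + l) * b k) *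
          cos (l * φ) := by
      rw [sum_mul]
      refine sum_congr rfl fun k _ => ?_
      simp only [U]
      push_cast
      rw [add_sub_cancel_left]
      ring
    have h₂ : ∑ k ∈ Icc (l + 1) (N + l), U (k - l) k = (∑ k ∈ Icc (l + 1) (N + l),
        ((1 / 2 : ℝ) * α - ((5 / 6 : ℝ) * k - (1 / 3) * l) * k) * b ((k : ℤ) - l) * b k) *
          cos (l * φ) := by
      rw [sum_mul]
      refine sum_congr rfl fun k hk => ?_
      have hk' : l ≤ k := by
        simp only [mem_Icc] at hk
        omega
      simp only [U]
      push_cast [hk']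
      rw [show ((k : ℝ) - l - k) * φ = -(l * φ) by ring, cos_neg]
      ring
    have h₃ : ∑ k ∈ Icc 1 (l - 1), V (l - k) k = (∑ k ∈ Icc 1 (l - 1),
        ((1 / 2 : ℝ) * α + ((1 / 3 : ℝ) * l - (5 / 6) * k) * k) * b k * b ((l : ℤ) - k)) *
          cos (l * φ) := by
      rw [sum_mul]
      refine sum_congr rfl fun k hk => ?_
      have hk' : k ≤ l := by
        simp only [mem_Icc] at hk
        omega
      simp only [V]
      push_cast [hk']
      rw [sub_add_cancel]
      ring
    rw [h₁, h₂, h₃]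
    ring
  rw [sum_congr rfl hterm]
  simp only [sum_add_distrib]
  ring

/-- The part of the expansion that is linear in the coefficients. -/
theorem linear_cos_expansion (a₁ a₂ a₄ a₅ a₆ : ℝ) {N M : ℕ} {b : ℤ → ℝ}
    (hb : ∀ m : ℤ, m < 0 ∨ (N : ℤ) < m → b m = 0) (hM : N + 2 ≤ M) (φ : ℝ) :
    (a₁ * sin φ + a₂ * sin (2 * φ)) * (∑ n ∈ range (N + 1), -(n * b n) * sin (n * φ))
        + (a₄ + a₅ * cos φ + a₆ * cos (2 * φ)) * (∑ n ∈ range (N + 1), b n * cos (n * φ)) =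
      - (1 / 2) * a₁ * b 1 - a₂ * b 2 + (1 / 2) * a₆ * b 2 + (1 / 2) * a₅ * b 1 + a₄ * b 0
      + ((1 / 2) * a₅ * b 0 + (1 / 2) * a₆ * b 1 - (1 / 2) * a₂ * b 1) * cos φ
      + (1 / 2) * a₆ * b 0 * cos (2 * φ) +
      ∑ l ∈ Icc 1 M,
        (a₄ * b l
          + (1 / 2) * a₅ * b ((l : ℤ) - 1) + (1 / 2) * a₆ * b ((l : ℤ) - 2)
          + (1 / 2) * a₅ * b (l + 1) + (1 / 2) * a₆ * b (l + 2)
          + (1 / 2) * a₁ * ((l : ℝ) - 1) * b ((l : ℤ) - 1)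
          + (1 / 2) * a₂ * ((l : ℝ) - 2) * b ((l : ℤ) - 2)
          - (1 / 2) * a₁ * ((l : ℝ) + 1) * b (l + 1)
          - (1 / 2) * a₂ * ((l : ℝ) + 2) * b (l + 2)) * cos (l * φ) := by
  let G : ℝ → ℝ → ℤ → ℤ → ℝ := fun p q j m => (p + q * m) * b m * cos ((m + j) * φ)
  have hG : ∀ p q j, ∀ m : ℤ, m < 0 ∨ (N : ℤ) < m → G p q j m = 0 := by
    intro p q j m hm
    simp [G, hb m hm]
  have s₁ := sum_Icc_shift_sub (j := 1) (M := M) (hG (a₅ / 2) (a₁ / 2) 1) le_rfl (by omega)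
  have s₂ := sum_Icc_shift_sub (j := 2) (M := M) (hG (a₆ / 2) (a₂ / 2) 2) (by omega) hM
  have s₃ := sum_Icc_shift_add (M := M) 1 (hG (a₅ / 2) (-a₁ / 2) (-1)) (by omega)
  have s₄ := sum_Icc_shift_add (M := M) 2 (hG (a₆ / 2) (-a₂ / 2) (-2)) (by omega)
  have s₅ := sum_Icc_shift_add (M := M) 0 (hG a₄ 0 0) (by omega)
  have hterm : ∀ l ∈ Icc 1 M,
      (a₄ * b l
          + (1 / 2) * a₅ * b ((l : ℤ) - 1) + (1 / 2) * a₆ * b ((l : ℤ) - 2)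
          + (1 / 2) * a₅ * b (l + 1) + (1 / 2) * a₆ * b (l + 2)
          + (1 / 2) * a₁ * ((l : ℝ) - 1) * b ((l : ℤ) - 1)
          + (1 / 2) * a₂ * ((l : ℝ) - 2) * b ((l : ℤ) - 2)
          - (1 / 2) * a₁ * ((l : ℝ) + 1) * b (l + 1)
          - (1 / 2) * a₂ * ((l : ℝ) + 2) * b (l + 2)) * cos (l * φ) =
      G (a₅ / 2) (a₁ / 2) 1 ((l : ℤ) - (1 : ℕ)) + G (a₆ / 2) (a₂ / 2) 2 ((l : ℤ) - (2 : ℕ)) +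
      G (a₅ / 2) (-a₁ / 2) (-1) ((l : ℤ) + (1 : ℕ)) +
      G (a₆ / 2) (-a₂ / 2) (-2) ((l : ℤ) + (2 : ℕ)) + G a₄ 0 0 ((l : ℤ) + (0 : ℕ)) := by
    intro l _
    simp only [G]
    push_cast
    simp only [sub_add_cancel, add_neg_cancel_right, add_zero]
    ring
  have hlhs : (a₁ * sin φ + a₂ * sin (2 * φ)) * (∑ n ∈ range (N + 1), -(n * b n) * sin (n * φ))
        + (a₄ + a₅ * cos φ + a₆ * cos (2 * φ)) * (∑ n ∈ range (N + 1), b n * cos (n * φ)) =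
      ∑ n ∈ range (N + 1), G (a₅ / 2) (a₁ / 2) 1 n + ∑ n ∈ range (N + 1), G (a₆ / 2) (a₂ / 2) 2 n +
      ∑ n ∈ range (N + 1), G (a₅ / 2) (-a₁ / 2) (-1) n +
      ∑ n ∈ range (N + 1), G (a₆ / 2) (-a₂ / 2) (-2) n + ∑ n ∈ range (N + 1), G a₄ 0 0 n := by
    simp only [mul_sum, ← sum_add_distrib]
    refine sum_congr rfl fun n _ => ?_
    simp only [G]
    push_cast
    simp only [add_mul, neg_mul, one_mul, cos_add, cos_neg, sin_neg, add_zero, zero_mul]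
    ring
  have e₃ : ∑ n ∈ range (1 + 1), G (a₅ / 2) (-a₁ / 2) (-1) n =
      a₅ / 2 * b 0 * cos φ + (a₅ / 2 - a₁ / 2) * b 1 := by
    simp only [sum_range_succ, range_zero, sum_empty, G]
    push_cast
    rw [show ((0 : ℝ) + -1) * φ = -φ by ring, show ((1 : ℝ) + -1) * φ = 0 by ring, cos_neg,
      cos_zero]
    ring
  have e₄ : ∑ n ∈ range (2 + 1), G (a₆ / 2) (-a₂ / 2) (-2) n =
      a₆ / 2 * b 0 * cos (2 * φ) + (a₆ / 2 - a₂ / 2) * b 1 * cos φ + (a₆ / 2 - a₂) * b 2 := by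
    simp only [sum_range_succ, range_zero, sum_empty, G]
    push_cast
    rw [show ((0 : ℝ) + -2) * φ = -(2 * φ) by ring, show ((1 : ℝ) + -2) * φ = -φ by ring,
      show ((2 : ℝ) + -2) * φ = 0 by ring, cos_neg, cos_neg, cos_zero]
    ring
  have e₅ : ∑ n ∈ range (0 + 1), G a₄ 0 0 n = a₄ * b 0 := by
    simp [G]
  rw [sum_congr rfl hterm, hlhs]
  simp only [sum_add_distrib]
  rw [s₁, s₂, s₃, s₄, s₅, e₃, e₄, e₅]
  ring

/-- Expansion of the residual of the concentration ODE (2.31) for a truncated Fourier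
cosine series into a single cosine series. -/
theorem stmt_8 (a₁ a₂ a₃ a₄ a₅ a₆ : ℝ) (N : ℕ) (hN : 1 ≤ N)
    (b : ℤ → ℝ) (hb : ∀ m : ℤ, m < 0 ∨ (N : ℤ) < m → b m = 0)
    (f : ℝ → ℝ) (hf : f = fun φ => ∑ n ∈ Finset.range (N + 1), b n * Real.cos (n * φ))
    (A₀ : ℝ)
    (hA₀ : A₀ = (∑ n ∈ Finset.Icc 1 N, ((1 / 2 : ℝ) * a₃ - (5 / 6) * (n : ℝ) ^ 2) * b n ^ 2)
        + a₃ * b 0 ^ 2 - (1 / 2) * a₁ * b 1 - a₂ * b 2 + (1 / 2) * a₆ * b 2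
        + (1 / 2) * a₅ * b 1 + a₄ * b 0 - (3 / 16) * (a₁ ^ 2 + a₂ ^ 2))
    (A : ℕ → ℝ)
    (hA : ∀ l : ℕ, A l =
        (∑ k ∈ Finset.Icc 1 N,
          ((1 / 2 : ℝ) * a₃ - ((1 / 3 : ℝ) * l + (5 / 6) * k) * k) * b (k + l) * b k)
        + (∑ k ∈ Finset.Icc (l + 1) (N + l),
          ((1 / 2 : ℝ) * a₃ - ((5 / 6 : ℝ) * k - (1 / 3) * l) * k) * b ((k : ℤ) - l) * b k)
        - b 0 * (l : ℝ) ^ 2 * b l + a₄ * b l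
        + (1 / 2) * a₅ * b ((l : ℤ) - 1) + (1 / 2) * a₆ * b ((l : ℤ) - 2)
        + (1 / 2) * a₅ * b (l + 1) + (1 / 2) * a₆ * b (l + 2)
        + 2 * a₃ * b 0 * b l
        + (1 / 2) * a₁ * ((l : ℝ) - 1) * b ((l : ℤ) - 1)
        + (1 / 2) * a₂ * ((l : ℝ) - 2) * b ((l : ℤ) - 2)
        - (1 / 2) * a₁ * ((l : ℝ) + 1) * b (l + 1)
        - (1 / 2) * a₂ * ((l : ℝ) + 2) * b (l + 2))
    (B : ℕ → ℝ)
    (hB : ∀ l : ℕ, B l = ∑ k ∈ Finset.Icc 1 (l - 1),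
        ((1 / 2 : ℝ) * a₃ + ((1 / 3 : ℝ) * l - (5 / 6) * k) * k) * b k * b ((l : ℤ) - k))
    (C : ℕ → ℝ)
    (hC : ∀ l : ℕ, C l =
        if l = 1 then -(3 / 8) * a₁ * a₂ + (1 / 2) * a₅ * b 0 + (1 / 2) * a₆ * b 1
            - (1 / 2) * a₂ * b 1
        else if l = 2 then (1 / 2) * a₆ * b 0 + (3 / 16) * a₁ ^ 2
        else if l = 3 then (3 / 8) * a₁ * a₂
        else if l = 4 then (3 / 16) * a₂ ^ 2
        else 0) :
    ∀ φ : ℝ,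
      f φ * deriv (deriv f) φ - (2 / 3) * (deriv f φ) ^ 2
        + (a₁ * Real.sin φ + a₂ * Real.sin (2 * φ)) * deriv f φ
        + a₃ * (f φ) ^ 2
        + (a₄ + a₅ * Real.cos φ + a₆ * Real.cos (2 * φ)) * f φ
        - (3 / 8) * (a₁ * Real.sin φ + a₂ * Real.sin (2 * φ)) ^ 2
      = A₀ + ∑ l ∈ Finset.Icc 1 (2 * N + 4), (A l + B l + C l) * Real.cos (l * φ) := by
  
  intro φ
  have hC' : ∑ l ∈ Icc 1 (2 * N + 4), C l * cos (l * φ) =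
      C 1 * cos φ + C 2 * cos (2 * φ) + C 3 * cos (3 * φ) + C 4 * cos (4 * φ) := by
    have h : ∑ l ∈ Icc 1 4, C l * cos (l * φ) = ∑ l ∈ Icc 1 (2 * N + 4), C l * cos (l * φ) := by
      refine sum_subset (Icc_subset_Icc_right (by omega)) fun l hl hl' => ?_
      simp only [mem_Icc] at hl hl'
      rw [hC, if_neg (by omega), if_neg (by omega), if_neg (by omega), if_neg (by omega), zero_mul]
    rw [← h]
    simp [sum_Icc_succ_top]
  have hsq : (3 / 8) * (a₁ * sin φ + a₂ * sin (2 * φ)) ^ 2 =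
      (3 / 16) * (a₁ ^ 2 + a₂ ^ 2) + (3 / 8) * a₁ * a₂ * cos φ - (3 / 16) * a₁ ^ 2 * cos (2 * φ)
        - (3 / 8) * a₁ * a₂ * cos (3 * φ) - (3 / 16) * a₂ ^ 2 * cos (4 * φ) := by
    have h₁ : cos φ = cos (2 * φ) * cos φ + sin (2 * φ) * sin φ := by
      rw [← cos_sub]
      ring_nf
    have h₃ : cos (3 * φ) = cos (2 * φ) * cos φ - sin (2 * φ) * sin φ := by
      rw [← cos_add]
      ring_nf
    have h₂ : cos (2 * φ) = 1 - 2 * sin φ ^ 2 := by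
      rw [cos_two_mul, cos_sq']
      ring
    have h₄ : cos (4 * φ) = 1 - 2 * sin (2 * φ) ^ 2 := by
      rw [show 4 * φ = 2 * (2 * φ) by ring, cos_two_mul, cos_sq']
      ring
    linear_combination (-(3 / 8) * a₁ * a₂) * h₁ + (3 / 8) * a₁ * a₂ * h₃
      + (3 / 16) * a₁ ^ 2 * h₂ + (3 / 16) * a₂ ^ 2 * h₄
  have hq := quadratic_cos_expansion a₃ hb (M := 2 * N + 4) (by omega) φ
  have hl := linear_cos_expansion a₁ a₂ a₄ a₅ a₆ hb (M := 2 * N + 4) (by omega) φ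
  have hsum : ∑ l ∈ Icc 1 (2 * N + 4), (A l + B l + C l) * cos (l * φ) =
      ∑ l ∈ Icc 1 (2 * N + 4), (A l + B l) * cos (l * φ) +
      ∑ l ∈ Icc 1 (2 * N + 4), C l * cos (l * φ) := by
    rw [← sum_add_distrib]
    exact sum_congr rfl fun l _ => by ring
  have hf' : deriv f = fun φ => ∑ n ∈ range (N + 1), -(n * b n) * sin (n * φ) := by
    rw [hf]
    exact deriv_cos_sum (fun n => b n) _
  have hf'' : deriv (deriv f) = fun φ => ∑ n ∈ range (N + 1), n * -(n * b n) * cos (n * φ) := by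
    rw [hf']
    exact deriv_sin_sum (fun n => -(n * b n)) _
  have hC1 : C 1 = -(3 / 8) * a₁ * a₂ + (1 / 2) * a₅ * b 0 + (1 / 2) * a₆ * b 1
      - (1 / 2) * a₂ * b 1 := by simp [hC]
  have hC2 : C 2 = (1 / 2) * a₆ * b 0 + (3 / 16) * a₁ ^ 2 := by simp [hC]
  have hC3 : C 3 = (3 / 8) * a₁ * a₂ := by simp [hC]
  have hC4 : C 4 = (3 / 16) * a₂ ^ 2 := by simp [hC]
  rw [hf'', hf', hf, hsum, hC', hC1, hC2, hC3, hC4, hA₀]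
  have hsplit : ∀ S₁ S₂ z p q r s t u v w x y S₃ c : ℝ,
      (S₁ + S₂ - z + p + q + r + s + t + u + v + w - x - y + S₃) * c =
        (S₁ + S₂ - z + u + S₃) * c + (p + q + r + s + t + v + w - x - y) * c := by
    intros
    ring
  simp only [hA, hB, hsplit]
  rw [sum_add_distrib]
  linear_combination hq + hl - hsq
end

section
/- With the same data and definitions of A₀, A_l, B_l, C_l as in the Fourier expansion identity (real coefficients a₁,...,a₆, reals b₀,...,b_N with b_m = 0 for m < 0 or m > N, f(φ) = Σ_{n=0}^{N} bₙ cos(nφ)), the function f satisfies f(φ)f''(φ) - (2/3)f'(φ)² + (a₁ sin φ + a₂ sin 2φ)f'(φ) + a₃ f(φ)² + (a₄ + a₅ cos φ + a₆ cos 2φ)f(φ) = (3/8)(a₁ sin φ + a₂ sin 2φ)² for all φ ∈ ℝ if and only if A₀ = 0 and A_l + B_l + C_l = 0 for every integer l with 1 ≤ l ≤ 2N+4. -/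
open Real Finset

/-- Linear independence of `1, cos φ, cos 2φ, …` -/
lemma sum_mul_cos_eq_zero_iff (M : ℕ) (d : ℕ → ℝ) :
    (∀ φ : ℝ, ∑ l ∈ range M, d l * cos (l * φ) = 0) ↔ ∀ l < M, d l = 0 := by
  refine ⟨fun h l hl => ?_, fun h φ => sum_eq_zero fun l hl => by simp [h l (mem_range.1 hl)]⟩
  have hzero : ∑ l ∈ range M, d l • Polynomial.Chebyshev.chebyshevTsequence ℝ l = 0 := by
    refine Polynomial.eq_zero_of_infinite_isRoot _ ((Set.Icc_infinite (a := (-1 : ℝ)) (b := 1)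
      (by norm_num)).mono fun x hx => ?_)
    have hx' := h (arccos x)
    simp only [Set.mem_ofPred_eq, Polynomial.IsRoot.def, Polynomial.eval_finsetSum,
      Polynomial.eval_smul, smul_eq_mul]
    rw [← hx']
    refine sum_congr rfl fun l _ => ?_
    have := Polynomial.Chebyshev.T_real_cos (arccos x) l
    rw [cos_arccos hx.1 hx.2] at this
    exact congrArg _ (by simpa [Polynomial.Chebyshev.chebyshevTsequence] using this)
  exact linearIndependent_iff'.1 (Polynomial.Chebyshev.chebyshevTsequence ℝ).linearIndependent (range M) d hzero l
    (mem_range.2 hl)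

/-- Reindexing a finite two-sided sum by a translation. -/
lemma sum_Icc_mul_add (K M : ℤ) (u h : ℤ → ℝ) (hu : ∀ n, n < -K ∨ K < n → u n = 0) (j : ℤ)
    (hj : |j| + K ≤ M) :
    ∑ n ∈ Icc (-K) K, u n * h (n + j) = ∑ l ∈ Icc (-M) M, u (l - j) * h l := by
  refine sum_of_injOn (fun n => n + j) (fun _ _ _ _ => by simp) ?_ ?_ ?_
  · intro n hn
    simp at hn ⊢
    grind
  · intro l _ hl
    rw [hu, zero_mul]
    by_contra hcon
    exact hl ⟨l - j, by simp; omega, by simp⟩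
  · intro n _
    simp

/-- Reflection of a symmetric two-sided sum. -/
lemma sum_Icc_neg_comp_neg (K : ℤ) (u : ℤ → ℝ) :
    ∑ n ∈ Icc (-K) K, u (-n) = ∑ n ∈ Icc (-K) K, u n :=
  sum_nbij' (fun n => -n) (fun n => -n) (by simp; grind) (by simp; grind) (by simp) (by simp)
    (by simp)

/-- Sine sums of even sequences vanish. -/
lemma sum_Icc_eq_zero_of_odd (K : ℤ) (u : ℤ → ℝ) (hu : ∀ n, u (-n) = -u n) :
    ∑ n ∈ Icc (-K) K, u n = 0 := by
  have := sum_Icc_neg_comp_neg K u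
  simp only [hu, sum_neg_distrib] at this
  linarith

/-- Folding a two-sided sum onto the nonnegative integers. -/
lemma sum_Icc_eq_of_even (M : ℕ) (u : ℤ → ℝ) (hu : ∀ n, u (-n) = u n) :
    ∑ l ∈ Icc (-M : ℤ) M, u l = u 0 + ∑ l ∈ Icc 1 M, 2 * u l := by
  induction M with
  | zero => simp
  | succ M ih =>
    rw [sum_Icc_succ_top (by omega), ← add_assoc, ← ih]
    have : Icc (-((M + 1 : ℕ) : ℤ)) ((M + 1 : ℕ) : ℤ) =
        insert (-((M + 1 : ℕ) : ℤ)) (insert ((M + 1 : ℕ) : ℤ) (Icc (-M : ℤ) M)) := by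
      ext x; simp; omega
    rw [this, sum_insert (by simp; omega), sum_insert (by simp), hu]
    ring

/-- Product formula for two-sided trigonometric sums. -/
lemma cos_sum_mul_sub_sin_sum_mul (K M : ℤ) (hM : 2 * K ≤ M) (u v : ℤ → ℝ)
    (hu : ∀ n, n < -K ∨ K < n → u n = 0) (φ : ℝ) :
    (∑ n ∈ Icc (-K) K, u n * cos (n * φ)) * (∑ n ∈ Icc (-K) K, v n * cos (n * φ))
      - (∑ n ∈ Icc (-K) K, u n * sin (n * φ)) * (∑ n ∈ Icc (-K) K, v n * sin (n * φ))
    = ∑ l ∈ Icc (-M) M, (∑ n ∈ Icc (-K) K, u (l - n) * v n) * cos (l * φ) := by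
  simp_rw [sum_mul_sum, ← sum_sub_distrib]
  rw [sum_comm]
  simp_rw [sum_mul]
  rw [sum_comm (s := Icc (-M) M)]
  refine sum_congr rfl fun n hn => ?_
  have hn' : |n| + K ≤ M := by
    have := abs_le.2 (mem_Icc.1 hn)
    omega
  have := sum_Icc_mul_add K M u (fun l => cos (l * φ)) hu n hn'
  calc _ = v n * ∑ m ∈ Icc (-K) K, u m * cos ((m + n : ℤ) * φ) := by
        rw [mul_sum]
        refine sum_congr rfl fun m _ => ?_
        push_cast
        rw [add_mul, cos_add]
        ring
    _ = _ := by
        rw [this, mul_sum]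
        exact sum_congr rfl fun m _ => by ring

/-- The Fourier coefficient of index `l` of the left-hand side of the differential equation, for
the two-sided coefficient sequence `c` supported in `[-K, K]`. -/
noncomputable def odeCoeff (a₁ a₂ a₃ a₄ a₅ a₆ : ℝ) (K : ℤ) (c : ℤ → ℝ) (l : ℤ) : ℝ :=
  ∑ n ∈ Icc (-K) K, (a₃ + 2 / 3 * (l : ℝ) * n - 5 / 3 * (n : ℝ) ^ 2) * (c (l - n) * c n)
    + a₄ * c l
    + a₅ / 2 * (c (l - 1) + c (l + 1)) + a₆ / 2 * (c (l - 2) + c (l + 2))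
    + a₁ / 2 * (((l : ℝ) - 1) * c (l - 1) - ((l : ℝ) + 1) * c (l + 1))
    + a₂ / 2 * (((l : ℝ) - 2) * c (l - 2) - ((l : ℝ) + 2) * c (l + 2))

lemma odeCoeff_neg (a₁ a₂ a₃ a₄ a₅ a₆ : ℝ) (K : ℤ) (c : ℤ → ℝ) (hc : ∀ n, c (-n) = c n) (l : ℤ) :
    odeCoeff a₁ a₂ a₃ a₄ a₅ a₆ K c (-l) = odeCoeff a₁ a₂ a₃ a₄ a₅ a₆ K c l := by
  unfold odeCoeff
  rw [← sum_Icc_neg_comp_neg]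
  have h (x y : ℤ) (hxy : x = -y) : c x = c y := by rw [hxy, hc]
  rw [h (-l) l rfl, h (-l - 1) (l + 1) (by ring), h (-l - 2) (l + 2) (by ring),
    h (-l + 1) (l - 1) (by ring), h (-l + 2) (l - 2) (by ring)]
  rw [sum_congr rfl fun n _ => by rw [h (-n) n rfl, h (-l - -n) (l - n) (by ring)]]
  push_cast
  ring_nf

/-- Multiplying a two-sided cosine sum by `cos (jφ)`. -/
lemma cos_mul_cos_sum (K M : ℤ) (c : ℤ → ℝ) (hc : ∀ n, n < -K ∨ K < n → c n = 0) (j : ℤ)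
    (hj : |j| + K ≤ M) (φ : ℝ) :
    cos (j * φ) * ∑ n ∈ Icc (-K) K, c n * cos (n * φ)
      = ∑ l ∈ Icc (-M) M, 1 / 2 * (c (l - j) + c (l + j)) * cos (l * φ) := by
  have h₁ := sum_Icc_mul_add K M c (fun l => cos (l * φ)) hc j hj
  have h₂ := sum_Icc_mul_add K M c (fun l => cos (l * φ)) hc (-j) (by rwa [abs_neg])
  simp only [sub_neg_eq_add] at h₂
  simp_rw [mul_assoc, ← mul_sum, add_mul, sum_add_distrib]
  rw [← h₁, ← h₂, ← sum_add_distrib, mul_sum, mul_sum]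
  refine sum_congr rfl fun n _ => ?_
  push_cast
  rw [add_mul, add_mul, cos_add, cos_add, neg_mul, cos_neg, sin_neg]
  ring

/-- Multiplying a two-sided sine sum by `sin (jφ)`. -/
lemma sin_mul_sin_sum (K M : ℤ) (c : ℤ → ℝ) (hc : ∀ n, n < -K ∨ K < n → c n = 0) (j : ℤ)
    (hj : |j| + K ≤ M) (φ : ℝ) :
    sin (j * φ) * ∑ n ∈ Icc (-K) K, c n * sin (n * φ)
      = ∑ l ∈ Icc (-M) M, 1 / 2 * (c (l + j) - c (l - j)) * cos (l * φ) := by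
  have h₁ := sum_Icc_mul_add K M c (fun l => cos (l * φ)) hc j hj
  have h₂ := sum_Icc_mul_add K M c (fun l => cos (l * φ)) hc (-j) (by rwa [abs_neg])
  simp only [sub_neg_eq_add] at h₂
  simp_rw [mul_assoc, ← mul_sum, sub_mul, sum_sub_distrib]
  rw [← h₁, ← h₂, ← sum_sub_distrib, mul_sum, mul_sum]
  refine sum_congr rfl fun n _ => ?_
  push_cast
  rw [add_mul, add_mul, cos_add, cos_add, neg_mul, cos_neg, sin_neg]
  ring

/-- The differential operator applied to an even two-sided trigonometric sum. -/
lemma ode_eq_sum_odeCoeff (a₁ a₂ a₃ a₄ a₅ a₆ : ℝ) (K M : ℤ) (h₁ : 2 * K ≤ M) (h₂ : K + 2 ≤ M)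
    (c : ℤ → ℝ) (hc : ∀ n, n < -K ∨ K < n → c n = 0) (heven : ∀ n, c (-n) = c n) (f : ℝ → ℝ)
    (hf : f = fun φ => ∑ n ∈ Icc (-K) K, c n * cos (n * φ)) (φ : ℝ) :
    f φ * deriv (deriv f) φ - (2 / 3) * (deriv f φ) ^ 2
        + (a₁ * sin φ + a₂ * sin (2 * φ)) * deriv f φ
        + a₃ * (f φ) ^ 2
        + (a₄ + a₅ * cos φ + a₆ * cos (2 * φ)) * f φ
      = ∑ l ∈ Icc (-M) M, odeCoeff a₁ a₂ a₃ a₄ a₅ a₆ K c l * cos (l * φ) := by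
  have hf' : deriv f = fun φ => -∑ n ∈ Icc (-K) K, (n * c n) * sin (n * φ) := by
    funext x
    rw [hf, ← sum_neg_distrib]
    refine (HasDerivAt.fun_sum fun n _ => ?_).deriv
    refine ((((hasDerivAt_id' x).const_mul (n : ℝ)).cos).const_mul (c n)).congr_deriv ?_
    ring
  have hf'' : deriv (deriv f) = fun φ => -∑ n ∈ Icc (-K) K, (n ^ 2 * c n) * cos (n * φ) := by
    funext x
    rw [hf', ← sum_neg_distrib]
    simp_rw [← sum_neg_distrib]
    refine (HasDerivAt.fun_sum fun n _ => ?_).deriv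
    refine ((((hasDerivAt_id' x).const_mul (n : ℝ)).sin).const_mul
      (n * c n)).fun_neg.congr_deriv ?_
    ring
  have hc' : ∀ n : ℤ, n < -K ∨ K < n → n * c n = 0 := fun n hn => by rw [hc n hn, mul_zero]
  have hodd : ∑ n ∈ Icc (-K) K, c n * sin (n * φ) = 0 :=
    sum_Icc_eq_zero_of_odd K _ fun n => by simp [heven]
  have hodd' : ∑ n ∈ Icc (-K) K, (n * c n) * cos (n * φ) = 0 :=
    sum_Icc_eq_zero_of_odd K _ fun n => by simp [heven]
  have e₁ := cos_sum_mul_sub_sin_sum_mul K M h₁ c (fun n => n ^ 2 * c n) hc φ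
  have e₂ := cos_sum_mul_sub_sin_sum_mul K M h₁ (fun n => n * c n) (fun n => n * c n) hc' φ
  have e₃ := cos_sum_mul_sub_sin_sum_mul K M h₁ c c hc φ
  have e₄ := cos_mul_cos_sum K M c hc 0 (by rw [abs_zero]; omega) φ
  have e₅ := cos_mul_cos_sum K M c hc 1 (by rw [abs_one]; omega) φ
  have e₆ := cos_mul_cos_sum K M c hc 2 (by rw [abs_two]; omega) φ
  have e₇ := sin_mul_sin_sum K M (fun n => n * c n) hc' 1 (by rw [abs_one]; omega) φ
  have e₈ := sin_mul_sin_sum K M (fun n => n * c n) hc' 2 (by rw [abs_two]; omega) φ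
  simp only [hodd, hodd', zero_mul, sub_zero, zero_sub] at e₁ e₂ e₃
  have hsplit : ∑ l ∈ Icc (-M) M, odeCoeff a₁ a₂ a₃ a₄ a₅ a₆ K c l * cos (l * φ) =
      -(∑ l ∈ Icc (-M) M, (∑ n ∈ Icc (-K) K, c (l - n) * (n ^ 2 * c n)) * cos (l * φ))
      + 2 / 3 * (∑ l ∈ Icc (-M) M,
        (∑ n ∈ Icc (-K) K, (((l - n : ℤ) : ℝ) * c (l - n)) * (n * c n)) * cos (l * φ))
      + a₃ * (∑ l ∈ Icc (-M) M, (∑ n ∈ Icc (-K) K, c (l - n) * c n) * cos (l * φ))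
      + a₄ * (∑ l ∈ Icc (-M) M, 1 / 2 * (c (l - 0) + c (l + 0)) * cos (l * φ))
      + a₅ * (∑ l ∈ Icc (-M) M, 1 / 2 * (c (l - 1) + c (l + 1)) * cos (l * φ))
      + a₆ * (∑ l ∈ Icc (-M) M, 1 / 2 * (c (l - 2) + c (l + 2)) * cos (l * φ))
      - a₁ * (∑ l ∈ Icc (-M) M,
        1 / 2 * ((l + 1 : ℤ) * c (l + 1) - (l - 1 : ℤ) * c (l - 1)) * cos (l * φ))
      - a₂ * (∑ l ∈ Icc (-M) M,
        1 / 2 * ((l + 2 : ℤ) * c (l + 2) - (l - 2 : ℤ) * c (l - 2)) * cos (l * φ)) := by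
    simp only [mul_sum (Icc (-M) M), ← sum_neg_distrib, ← sum_add_distrib, ← sum_sub_distrib]
    refine sum_congr rfl fun l _ => ?_
    have hq : ∑ n ∈ Icc (-K) K, (a₃ + 2 / 3 * (l : ℝ) * n - 5 / 3 * (n : ℝ) ^ 2) *
          (c (l - n) * c n) = -(∑ n ∈ Icc (-K) K, c (l - n) * (n ^ 2 * c n))
        + 2 / 3 * ∑ n ∈ Icc (-K) K, (((l - n : ℤ) : ℝ) * c (l - n)) * (n * c n)
        + a₃ * ∑ n ∈ Icc (-K) K, c (l - n) * c n := by
      simp only [mul_sum, ← sum_neg_distrib, ← sum_add_distrib]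
      refine sum_congr rfl fun n _ => ?_
      push_cast
      ring
    rw [odeCoeff, hq]
    push_cast
    simp only [sub_zero, add_zero]
    ring
  rw [hsplit, ← e₁, ← e₂, ← e₃, ← e₄, ← e₅, ← e₆, ← e₇, ← e₈, hf'', hf', hf]
  push_cast
  simp only [one_mul, zero_mul, cos_zero]
  ring

/-- Sum over nonnegative indices not exceeding `l` hidden in a two-sided sum. -/
lemma sum_Icc_mul_mul_sub (N l : ℕ) (b : ℤ → ℝ) (hb : ∀ m : ℤ, m < 0 ∨ (N : ℤ) < m → b m = 0)
    (w : ℤ → ℝ) :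
    ∑ n ∈ Icc (-N : ℤ) N, w n * (b (l - n) * b n)
      = ∑ k ∈ range (l + 1), w k * (b k * b ((l : ℤ) - k)) := by
  have h : ∑ n ∈ Icc (-(N + l : ℕ) : ℤ) (N + l : ℕ), w n * (b (l - n) * b n) =
      ∑ n ∈ Icc (-N : ℤ) N, w n * (b (l - n) * b n) :=
    (sum_subset (Icc_subset_Icc (by omega) (by omega)) fun x _ hx => by
      rw [hb x (by simp at hx; omega)]; simp).symm
  rw [← h]
  symm
  refine sum_of_injOn (fun k => (k : ℤ)) (fun _ _ _ _ => by simp) ?_ ?_ ?_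
  · intro n hn
    simp at hn ⊢
    omega
  · intro n _ hn
    by_cases h0 : n < 0
    · rw [hb n (Or.inl h0)]; simp
    · rw [hb (l - n) (Or.inl ?_)]
      · simp
      · by_contra hcon
        exact hn ⟨n.toNat, by simp; omega, by simp; omega⟩
  · intro n _
    ring

/-- Sum over indices at least `l` hidden in a two-sided sum. -/
lemma sum_Icc_mul_mul_sub_right (N l : ℕ) (b : ℤ → ℝ)
    (hb : ∀ m : ℤ, m < 0 ∨ (N : ℤ) < m → b m = 0) (w : ℤ → ℝ) :
    ∑ n ∈ Icc (-N : ℤ) N, w n * (b (n - l) * b n)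
      = ∑ k ∈ Icc l (N + l), w k * (b ((k : ℤ) - l) * b k) := by
  have h : ∑ n ∈ Icc (-(N + l : ℕ) : ℤ) (N + l : ℕ), w n * (b (n - l) * b n) =
      ∑ n ∈ Icc (-N : ℤ) N, w n * (b (n - l) * b n) :=
    (sum_subset (Icc_subset_Icc (by omega) (by omega)) fun x _ hx => by
      rw [hb x (by simp at hx; omega)]; simp).symm
  rw [← h]
  symm
  refine sum_of_injOn (fun k => (k : ℤ)) (fun _ _ _ _ => by simp) ?_ ?_ (fun _ _ => rfl)
  · intro n hn
    simp at hn ⊢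
    omega
  · intro n hn' hn
    rw [hb (n - l) (Or.inl ?_)]
    · simp
    · by_contra hcon
      simp at hn'
      exact hn ⟨n.toNat, by simp; omega, by simp; omega⟩

/-- Sum over nonpositive indices hidden in a two-sided sum. -/
lemma sum_Icc_mul_mul_neg (N l : ℕ) (b : ℤ → ℝ)
    (hb : ∀ m : ℤ, m < 0 ∨ (N : ℤ) < m → b m = 0) (w : ℤ → ℝ) :
    ∑ n ∈ Icc (-N : ℤ) N, w n * (b (l - n) * b (-n))
      = ∑ k ∈ range (N + 1), w (-k) * (b (k + l) * b k) := by
  symm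
  refine sum_of_injOn (fun k => (-k : ℤ)) (fun _ _ _ _ => by simp) ?_ ?_ ?_
  · intro n hn
    simp at hn ⊢
    omega
  · intro n hn' hn
    rw [hb (-n) (Or.inl ?_)]
    · simp
    · by_contra hcon
      simp at hn'
      exact hn ⟨(-n).toNat, by simp; omega, by simp; omega⟩
  · intro n _
    simp only [neg_neg, sub_neg_eq_add, add_comm (l : ℤ)]

lemma sum_range_succ_eq_add_Icc (N : ℕ) (u : ℕ → ℝ) :
    ∑ k ∈ range (N + 1), u k = u 0 + ∑ k ∈ Icc 1 N, u k := by
  have : range (N + 1) = insert 0 (Icc 1 N) := by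
    ext x; simp; omega
  rw [this, sum_insert (by simp)]

lemma sum_Icc_eq_add_Icc_succ (l m : ℕ) (h : l ≤ m) (u : ℕ → ℝ) :
    ∑ k ∈ Icc l m, u k = u l + ∑ k ∈ Icc (l + 1) m, u k := by
  have : Icc l m = insert l (Icc (l + 1) m) := by
    ext x; simp; omega
  rw [this, sum_insert (by simp)]

/-- The quadratic part of the zeroth Fourier coefficient. -/
lemma quadratic_coeff_zero (a₃ : ℝ) (N : ℕ) (b : ℤ → ℝ)
    (hb : ∀ m : ℤ, m < 0 ∨ (N : ℤ) < m → b m = 0) (c : ℤ → ℝ)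
    (hc : ∀ n, c n = (b n + b (-n)) / 2) :
    ∑ n ∈ Icc (-N : ℤ) N, (a₃ + 2 / 3 * ((0 : ℤ) : ℝ) * n - 5 / 3 * (n : ℝ) ^ 2)
        * (c (0 - n) * c n)
      = (∑ n ∈ Icc 1 N, ((1 / 2 : ℝ) * a₃ - (5 / 6) * (n : ℝ) ^ 2) * b n ^ 2) + a₃ * b 0 ^ 2 := by
  have e₁ := sum_Icc_mul_mul_sub N 0 b hb fun n => a₃ - 5 / 3 * (n : ℝ) ^ 2
  have e₂ := sum_Icc_mul_mul_sub_right N 0 b hb fun n => a₃ - 5 / 3 * (n : ℝ) ^ 2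
  have e₃ := sum_Icc_mul_mul_neg N 0 b hb fun n => a₃ - 5 / 3 * (n : ℝ) ^ 2
  rw [sum_range_succ_eq_add_Icc] at e₃
  rw [sum_Icc_eq_add_Icc_succ _ _ (by omega)] at e₂
  simp only [zero_add, add_zero, Nat.cast_zero, sub_zero, zero_sub, sum_range_one, Int.cast_zero,
    Int.cast_neg, Int.cast_natCast, neg_sq] at e₁ e₂ e₃
  calc _ = 1 / 4 * (2 * (∑ n ∈ Icc (-N : ℤ) N, (a₃ - 5 / 3 * (n : ℝ) ^ 2) * (b (-n) * b n))
        + (∑ n ∈ Icc (-N : ℤ) N, (a₃ - 5 / 3 * (n : ℝ) ^ 2) * (b n * b n))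
        + ∑ n ∈ Icc (-N : ℤ) N, (a₃ - 5 / 3 * (n : ℝ) ^ 2) * (b (-n) * b (-n))) := by
        simp only [mul_sum, ← sum_add_distrib]
        refine sum_congr rfl fun n _ => ?_
        rw [hc, hc, zero_sub, neg_neg]
        push_cast
        ring
    _ = 1 / 4 * (4 * (a₃ * b 0 ^ 2)
        + 2 * ∑ n ∈ Icc 1 N, (a₃ - 5 / 3 * (n : ℝ) ^ 2) * (b n * b n)) := by
        rw [e₁, e₂, e₃]
        simp
        ring
    _ = _ := by
        simp only [mul_add, mul_sum]
        rw [add_comm]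
        congr 1
        · exact sum_congr rfl fun n _ => by ring
        · ring

/-- The quadratic part of the Fourier coefficient of positive index `l`. -/
lemma quadratic_coeff_pos (a₃ : ℝ) (N l : ℕ) (hl : 1 ≤ l) (b : ℤ → ℝ)
    (hb : ∀ m : ℤ, m < 0 ∨ (N : ℤ) < m → b m = 0) (c : ℤ → ℝ)
    (hc : ∀ n, c n = (b n + b (-n)) / 2) :
    2 * ∑ n ∈ Icc (-N : ℤ) N, (a₃ + 2 / 3 * ((l : ℤ) : ℝ) * n - 5 / 3 * (n : ℝ) ^ 2)
        * (c (l - n) * c n)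
      = (∑ k ∈ Icc 1 N,
          ((1 / 2 : ℝ) * a₃ - ((1 / 3 : ℝ) * l + (5 / 6) * k) * k) * b (k + l) * b k)
        + (∑ k ∈ Icc (l + 1) (N + l),
          ((1 / 2 : ℝ) * a₃ - ((5 / 6 : ℝ) * k - (1 / 3) * l) * k) * b ((k : ℤ) - l) * b k)
        + (∑ k ∈ Icc 1 (l - 1),
          ((1 / 2 : ℝ) * a₃ + ((1 / 3 : ℝ) * l - (5 / 6) * k) * k) * b k * b ((l : ℤ) - k))
        + (2 * a₃ - (l : ℝ) ^ 2) * b 0 * b l := by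
  have e₁ := sum_Icc_mul_mul_sub N l b hb fun n => a₃ + 2 / 3 * (l : ℝ) * n - 5 / 3 * (n : ℝ) ^ 2
  have e₂ := sum_Icc_mul_mul_sub_right N l b hb
    fun n => a₃ + 2 / 3 * (l : ℝ) * n - 5 / 3 * (n : ℝ) ^ 2
  have e₃ := sum_Icc_mul_mul_neg N l b hb fun n => a₃ + 2 / 3 * (l : ℝ) * n - 5 / 3 * (n : ℝ) ^ 2
  rw [sum_range_succ_eq_add_Icc] at e₃
  rw [sum_Icc_eq_add_Icc_succ _ _ (by omega)] at e₂
  obtain ⟨m, rfl⟩ : ∃ m, l = m + 1 := ⟨l - 1, by omega⟩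
  rw [sum_range_succ, sum_range_succ_eq_add_Icc] at e₁
  calc _ = 1 / 2 * (
        (∑ n ∈ Icc (-N : ℤ) N, (a₃ + 2 / 3 * ((m + 1 : ℕ) : ℝ) * n - 5 / 3 * (n : ℝ) ^ 2)
          * (b ((m + 1 : ℕ) - n) * b n))
        + (∑ n ∈ Icc (-N : ℤ) N, (a₃ + 2 / 3 * ((m + 1 : ℕ) : ℝ) * n - 5 / 3 * (n : ℝ) ^ 2)
          * (b (n - (m + 1 : ℕ)) * b n))
        + ∑ n ∈ Icc (-N : ℤ) N, (a₃ + 2 / 3 * ((m + 1 : ℕ) : ℝ) * n - 5 / 3 * (n : ℝ) ^ 2)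
          * (b ((m + 1 : ℕ) - n) * b (-n))) := by
        simp only [mul_sum, ← sum_add_distrib]
        refine sum_congr rfl fun n _ => ?_
        have hz : b (n - (m + 1 : ℕ)) * b (-n) = 0 := by
          by_cases hn : n < (m + 1 : ℕ)
          · rw [hb (n - (m + 1 : ℕ)) (Or.inl (by omega)), zero_mul]
          · rw [hb (-n) (Or.inl (by omega)), mul_zero]
        rw [hc, hc, neg_sub]
        simp only [Int.cast_natCast]
        linear_combination
          (1 / 2 * (a₃ + 2 / 3 * ((m + 1 : ℕ) : ℝ) * n - 5 / 3 * (n : ℝ) ^ 2)) * hz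
    _ = _ := by
        rw [e₁, e₂, e₃]
        simp only [Nat.add_sub_cancel, mul_add, mul_sum, sub_self, Int.cast_zero, Int.cast_natCast,
          Nat.cast_zero, zero_add, neg_zero, sub_zero, Int.cast_neg]
        have h₁ : ∀ k : ℕ, 1 / 2 * ((a₃ + 2 / 3 * ((m + 1 : ℕ) : ℝ) * -k - 5 / 3 * (-k : ℝ) ^ 2) *
            (b (k + (m + 1 : ℕ)) * b k)) = ((1 / 2 : ℝ) * a₃ - ((1 / 3 : ℝ) * ((m + 1 : ℕ) : ℝ)
              + (5 / 6) * k) * k) * b (k + (m + 1 : ℕ)) * b k := fun k => by ring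
        have h₂ : ∀ k : ℕ, 1 / 2 * ((a₃ + 2 / 3 * ((m + 1 : ℕ) : ℝ) * k - 5 / 3 * (k : ℝ) ^ 2) *
            (b (k - (m + 1 : ℕ)) * b k)) = ((1 / 2 : ℝ) * a₃ - ((5 / 6 : ℝ) * k
              - (1 / 3) * ((m + 1 : ℕ) : ℝ)) * k) * b (k - (m + 1 : ℕ)) * b k := fun k => by ring
        have h₃ : ∀ k : ℕ, 1 / 2 * ((a₃ + 2 / 3 * ((m + 1 : ℕ) : ℝ) * k - 5 / 3 * (k : ℝ) ^ 2) *
            (b k * b ((m + 1 : ℕ) - k))) = ((1 / 2 : ℝ) * a₃ + ((1 / 3 : ℝ) * ((m + 1 : ℕ) : ℝ)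
              - (5 / 6) * k) * k) * b k * b ((m + 1 : ℕ) - k) := fun k => by ring
        simp only [h₁, h₂, h₃]
        ring

/-- The squared forcing term as a cosine polynomial. -/
lemma forcing_sq_eq_sum (a₁ a₂ φ : ℝ) (M : ℕ) (hM : 4 ≤ M) :
    (3 / 8) * (a₁ * sin φ + a₂ * sin (2 * φ)) ^ 2 = (3 / 16) * (a₁ ^ 2 + a₂ ^ 2)
      + ∑ l ∈ Icc 1 M, (if l = 1 then (3 / 8) * a₁ * a₂ else if l = 2 then -(3 / 16) * a₁ ^ 2
        else if l = 3 then -(3 / 8) * a₁ * a₂ else if l = 4 then -(3 / 16) * a₂ ^ 2 else 0)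
          * cos (l * φ) := by
  rw [← sum_subset (Icc_subset_Icc_right hM (a := 1)) fun x hx hx' => ?_]
  · have h₄ : cos (4 * φ) = 2 * cos (2 * φ) ^ 2 - 1 := by rw [← cos_two_mul]; ring_nf
    simp only [sum_Icc_succ_top, Nat.reduceAdd, Nat.reduceLeDiff, Icc_self, sum_singleton]
    norm_num
    rw [h₄, cos_three_mul, cos_two_mul, sin_two_mul]
    have := sin_sq_add_cos_sq φ
    have hs : sin φ ^ 2 = 1 - cos φ ^ 2 := by linarith
    linear_combination (3 / 8 * a₁ ^ 2 + 3 / 2 * a₁ * a₂ * cos φ + 3 / 2 * a₂ ^ 2 * cos φ ^ 2) * hs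
  · simp only [mem_Icc, not_and, not_le] at hx hx'
    rw [if_neg (by omega), if_neg (by omega), if_neg (by omega), if_neg (by omega), zero_mul]

/-- A truncated Fourier cosine series solves the concentration ODE (2.31) iff the
Fourier coefficients satisfy the nonlinear algebraic system `A₀ = 0`,
`A_l + B_l + C_l = 0` for `1 ≤ l ≤ 2N + 4`. -/
theorem stmt_9 (a₁ a₂ a₃ a₄ a₅ a₆ : ℝ) (N : ℕ) (hN : 1 ≤ N)
    (b : ℤ → ℝ) (hb : ∀ m : ℤ, m < 0 ∨ (N : ℤ) < m → b m = 0)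
    (f : ℝ → ℝ) (hf : f = fun φ => ∑ n ∈ Finset.range (N + 1), b n * Real.cos (n * φ))
    (A₀ : ℝ)
    (hA₀ : A₀ = (∑ n ∈ Finset.Icc 1 N, ((1 / 2 : ℝ) * a₃ - (5 / 6) * (n : ℝ) ^ 2) * b n ^ 2)
        + a₃ * b 0 ^ 2 - (1 / 2) * a₁ * b 1 - a₂ * b 2 + (1 / 2) * a₆ * b 2
        + (1 / 2) * a₅ * b 1 + a₄ * b 0 - (3 / 16) * (a₁ ^ 2 + a₂ ^ 2))
    (A : ℕ → ℝ)
    (hA : ∀ l : ℕ, A l =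
        (∑ k ∈ Finset.Icc 1 N,
          ((1 / 2 : ℝ) * a₃ - ((1 / 3 : ℝ) * l + (5 / 6) * k) * k) * b (k + l) * b k)
        + (∑ k ∈ Finset.Icc (l + 1) (N + l),
          ((1 / 2 : ℝ) * a₃ - ((5 / 6 : ℝ) * k - (1 / 3) * l) * k) * b ((k : ℤ) - l) * b k)
        - b 0 * (l : ℝ) ^ 2 * b l + a₄ * b l
        + (1 / 2) * a₅ * b ((l : ℤ) - 1) + (1 / 2) * a₆ * b ((l : ℤ) - 2)
        + (1 / 2) * a₅ * b (l + 1) + (1 / 2) * a₆ * b (l + 2)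
        + 2 * a₃ * b 0 * b l
        + (1 / 2) * a₁ * ((l : ℝ) - 1) * b ((l : ℤ) - 1)
        + (1 / 2) * a₂ * ((l : ℝ) - 2) * b ((l : ℤ) - 2)
        - (1 / 2) * a₁ * ((l : ℝ) + 1) * b (l + 1)
        - (1 / 2) * a₂ * ((l : ℝ) + 2) * b (l + 2))
    (B : ℕ → ℝ)
    (hB : ∀ l : ℕ, B l = ∑ k ∈ Finset.Icc 1 (l - 1),
        ((1 / 2 : ℝ) * a₃ + ((1 / 3 : ℝ) * l - (5 / 6) * k) * k) * b k * b ((l : ℤ) - k))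
    (C : ℕ → ℝ)
    (hC : ∀ l : ℕ, C l =
        if l = 1 then -(3 / 8) * a₁ * a₂ + (1 / 2) * a₅ * b 0 + (1 / 2) * a₆ * b 1
            - (1 / 2) * a₂ * b 1
        else if l = 2 then (1 / 2) * a₆ * b 0 + (3 / 16) * a₁ ^ 2
        else if l = 3 then (3 / 8) * a₁ * a₂
        else if l = 4 then (3 / 16) * a₂ ^ 2
        else 0) :
    (∀ φ : ℝ,
      f φ * deriv (deriv f) φ - (2 / 3) * (deriv f φ) ^ 2
        + (a₁ * Real.sin φ + a₂ * Real.sin (2 * φ)) * deriv f φ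
        + a₃ * (f φ) ^ 2
        + (a₄ + a₅ * Real.cos φ + a₆ * Real.cos (2 * φ)) * f φ
      = (3 / 8) * (a₁ * Real.sin φ + a₂ * Real.sin (2 * φ)) ^ 2) ↔
    (A₀ = 0 ∧ ∀ l : ℕ, 1 ≤ l → l ≤ 2 * N + 4 → A l + B l + C l = 0) := by
  set c : ℤ → ℝ := fun n => (b n + b (-n)) / 2 with hc
  have heven : ∀ n, c (-n) = c n := fun n => by simp only [hc, neg_neg]; ring
  have hsupp : ∀ n, n < -(N : ℤ) ∨ (N : ℤ) < n → c n = 0 := fun n hn => by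
    simp only [hc]
    rw [hb n (by omega), hb (-n) (by omega)]
    simp
  have hfc : f = fun φ => ∑ n ∈ Icc (-N : ℤ) N, c n * cos (n * φ) := by
    have hone (φ : ℝ) : ∑ n ∈ Icc (-N : ℤ) N, b n * cos (n * φ)
        = ∑ n ∈ range (N + 1), b n * cos (n * φ) := by
      symm
      refine sum_of_injOn (fun k => (k : ℤ)) (fun _ _ _ _ => by simp) ?_ ?_ (fun _ _ => by simp)
      · intro n hn
        simp at hn ⊢
        omega
      · intro n hn' hn
        rw [hb n (Or.inl ?_), zero_mul]
        by_contra hcon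
        simp at hn'
        exact hn ⟨n.toNat, by simp; omega, by simp; omega⟩
    rw [hf]
    funext φ
    have hrefl := sum_Icc_neg_comp_neg N fun n => b n * cos (n * φ)
    simp only [Int.cast_neg, neg_mul, cos_neg] at hrefl
    calc _ = (∑ n ∈ Icc (-N : ℤ) N, b n * cos (n * φ)
          + ∑ n ∈ Icc (-N : ℤ) N, b (-n) * cos (n * φ)) / 2 := by
          rw [hrefl, hone]
          ring
      _ = _ := by
          rw [← sum_add_distrib, sum_div]
          exact sum_congr rfl fun n _ => by simp only [hc]; ring
  have hzero : odeCoeff a₁ a₂ a₃ a₄ a₅ a₆ N c 0 - (3 / 16) * (a₁ ^ 2 + a₂ ^ 2) = A₀ := by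
    rw [hA₀, odeCoeff, quadratic_coeff_zero a₃ N b hb c fun _ => rfl]
    simp only [hc]
    norm_num
    rw [hb (-1) (by omega), hb (-2) (by omega)]
    ring
  have hpos : ∀ l : ℕ, 1 ≤ l → 2 * odeCoeff a₁ a₂ a₃ a₄ a₅ a₆ N c l
      - (if l = 1 then (3 / 8) * a₁ * a₂ else if l = 2 then -(3 / 16) * a₁ ^ 2
        else if l = 3 then -(3 / 8) * a₁ * a₂ else if l = 4 then -(3 / 16) * a₂ ^ 2 else 0)
      = A l + B l + C l := by
    intro l hl
    have hq := quadratic_coeff_pos a₃ N l hl b hb c fun _ => rfl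
    have hlin : ∀ j : ℤ, 0 < j → 2 * c j = b j := fun j hj => by
      simp only [hc]
      rw [hb (-j) (by omega)]
      ring
    have hc0 : c 0 = b 0 := by simp [hc]
    have hcm : 2 * c (-1) = b 1 := by rw [heven]; exact hlin 1 one_pos
    have hbm : b (-1) = 0 := hb _ (by omega)
    have hl₀ := hlin l (by omega)
    have hl₁ := hlin (l + 1) (by omega)
    have hl₂ := hlin (l + 2) (by omega)
    rw [hA, hB, hC, odeCoeff]
    simp only [Int.cast_natCast] at hq ⊢
    rcases (by omega : l = 1 ∨ l = 2 ∨ 3 ≤ l) with rfl | rfl | hl3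
    · norm_num at hq hl₀ hl₁ hl₂ ⊢
      rw [hbm]
      linear_combination hq + a₄ * hl₀ + (a₅ / 2 - a₁) * hl₁ + (a₆ / 2 - 3 / 2 * a₂) * hl₂
        + a₅ * hc0 + (a₆ / 2 - a₂ / 2) * hcm
    · have h1 := hlin 1 one_pos
      norm_num at hq hl₀ hl₁ hl₂ ⊢
      linear_combination hq + a₄ * hl₀ + (a₅ / 2 - 3 / 2 * a₁) * hl₁ + (a₆ / 2 - 2 * a₂) * hl₂
        + (a₅ / 2 + a₁ / 2) * h1 + a₆ * hc0
    · have hk₁ := hlin (l - 1) (by omega)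
      have hk₂ := hlin (l - 2) (by omega)
      rw [if_neg (by omega : l ≠ 1), if_neg (by omega : l ≠ 2), if_neg (by omega : l ≠ 1),
        if_neg (by omega : l ≠ 2)]
      have hforce : (if l = 3 then (3 / 8) * a₁ * a₂ else if l = 4 then (3 / 16) * a₂ ^ 2 else 0)
          = -(if l = 3 then -(3 / 8) * a₁ * a₂ else if l = 4 then -(3 / 16) * a₂ ^ 2 else 0) := by
        split_ifs <;> ring
      rw [hforce]
      linear_combination hq + a₄ * hl₀ + (a₅ / 2 - (l + 1) / 2 * a₁) * hl₁
        + (a₆ / 2 - (l + 2) / 2 * a₂) * hl₂ + (a₅ / 2 + (l - 1) / 2 * a₁) * hk₁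
        + (a₆ / 2 + (l - 2) / 2 * a₂) * hk₂
  set d : ℕ → ℝ := fun l => if l = 0 then A₀ else A l + B l + C l with hd
  have hexp : ∀ φ : ℝ,
      f φ * deriv (deriv f) φ - (2 / 3) * (deriv f φ) ^ 2
        + (a₁ * sin φ + a₂ * sin (2 * φ)) * deriv f φ
        + a₃ * (f φ) ^ 2
        + (a₄ + a₅ * cos φ + a₆ * cos (2 * φ)) * f φ
      - (3 / 8) * (a₁ * sin φ + a₂ * sin (2 * φ)) ^ 2
      = ∑ l ∈ range (2 * N + 4 + 1), d l * cos (l * φ) := by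
    intro φ
    rw [ode_eq_sum_odeCoeff a₁ a₂ a₃ a₄ a₅ a₆ N ((2 * N + 4 : ℕ) : ℤ) (by omega) (by omega) c
      hsupp heven f hfc φ, sum_Icc_eq_of_even _ _ fun n => by
        rw [odeCoeff_neg _ _ _ _ _ _ _ _ heven, Int.cast_neg, neg_mul, cos_neg],
      forcing_sq_eq_sum a₁ a₂ φ (2 * N + 4) (by omega), sum_range_succ_eq_add_Icc,
      add_sub_add_comm, ← sum_sub_distrib]
    congr 1
    · simp [hd, ← hzero]
    · refine sum_congr rfl fun l hl => ?_
      have hl1 := (mem_Icc.1 hl).1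
      simp only [hd, if_neg (by omega : l ≠ 0), ← hpos l hl1, Int.cast_natCast]
      ring
  rw [forall_congr' fun φ => sub_eq_zero.symm.trans (by rw [hexp φ]),
    sum_mul_cos_eq_zero_iff]
  constructor
  · intro h
    refine ⟨by simpa [hd] using h 0 (by omega), fun l hl hl' => ?_⟩
    have hl0 : l ≠ 0 := by omega
    simpa [hd, hl0] using h l (by omega)
  · rintro ⟨h0, h⟩ l hl
    by_cases hl0 : l = 0
    · simp [hd, hl0, h0]
    · simpa [hd, hl0] using h l (by omega) (by omega)
end
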